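/- (Deterministic core of the expected-decision bound.) In the Aleph poset model with a level function L, candidate prime unit U_c, coin function, and functions Π, Δ satisfying the Aleph recurrences: fix k ≥ 1, let ℓ = L(U_c) + 2k, and let v : Bool. If every prime unit V with L(V) = ℓ − 1 satisfies Π(V) = some v or Π(V) = none, and coin(ℓ − 1) = v, then every prime unit W with L(W) = ℓ + 2 satisfies Δ(W) = some v. -/

import Mathlib

open scoped Classical

/-- The number of distinct creators of units in `S` (the support count `#ₛS`). -/
noncomputable def suppCount {N : ℕ} {P : Type*} (c : P → Fin N) (S : Set P) : ℕ :=
  (c '' S).ncard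

/-- `HighAbove c V U` means `V ≫ U`: `U ≤ V` and the units between `U` and `V`
have at least `2N/3` distinct creators. -/
def HighAbove {N : ℕ} {P : Type*} [PartialOrder P] (c : P → Fin N) (V U : P) : Prop :=
  U ≤ V ∧ 2 * N ≤ 3 * suppCount c {W | U ≤ W ∧ W ≤ V}

/-- A unit `U` is prime if no unit `V < U` with the same creator has the same level. -/
def IsPrime {N : ℕ} {P : Type*} [PartialOrder P] (c : P → Fin N) (L : P → ℕ) (U : P) : Prop :=
  ¬ ∃ V, V < U ∧ c V = c U ∧ L V = L U

/-- `L` is a level function: it is monotone and every unit `W` of level `≥ 1` is high above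
prime units of level `L W - 1` created by at least `2N/3` distinct processes. -/
def IsLevelFn {N : ℕ} {P : Type*} [PartialOrder P] (c : P → Fin N) (L : P → ℕ) : Prop :=
  Monotone L ∧ ∀ W : P, 1 ≤ L W →
    2 * N ≤ 3 * suppCount c {X | HighAbove c W X ∧ L X = L W - 1 ∧ IsPrime c L X}

/-- The set `⇓U` of prime ancestors of `U`: prime units of level `L U - 1` high below `U`. -/
def primeAnc {N : ℕ} {P : Type*} [PartialOrder P] (c : P → Fin N) (L : P → ℕ) (U : P) :
    Set P :=
  {W | IsPrime c L W ∧ HighAbove c U W ∧ L W = L U - 1}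

/-- The supermajority operator. -/
noncomputable def SupMaj {N : ℕ} {P : Type*} (c : P → Fin N) (S : Set P)
    (f : P → Option Bool) : Option Bool :=
  if 2 * N ≤ 3 * suppCount c {U ∈ S | f U = some true} then some true
  else if 2 * N ≤ 3 * suppCount c {U ∈ S | f U = some false} then some false
  else none

/-- The existence operator (with preference for `true`). -/
noncomputable def ExistOp {P : Type*} (S : Set P) (f : P → Option Bool) : Option Bool :=
  if ∃ U ∈ S, f U = some true then some true
  else if ∃ U ∈ S, f U = some false then some false
  else none

/-- The randomized existence operator: as `ExistOp`, but falling back to the threshold coin.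
Here `ℓ` is the level of the unit whose prime ancestors form `S` (so units of `S` have
level `ℓ - 1`, and the coin with nonce `ℓ - 1` is used). -/
noncomputable def ExistTC {P : Type*} (coin : ℕ → Bool) (S : Set P)
    (f : P → Option Bool) (ℓ : ℕ) : Option Bool :=
  match ExistOp S f with
  | none => some (coin (ℓ - 1))
  | some b => some b

/-- The round type of a prime unit `U` relative to the candidate `Uc`:
`none` (⊥) for preliminary rounds, `some 0` for even and `some 1` for odd rounds. -/
def roundType {P : Type*} [PartialOrder P] (L : P → ℕ) (Uc U : P) : Option ℕ :=
  if L U ≤ L Uc + 1 then none else some ((L U - L Uc) % 2)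

/-- The Aleph recurrences for the proposal function `Pi` and the decision function `Delta`
with respect to the candidate prime unit `Uc` and the threshold coin `coin`. -/
def AlephRec {N : ℕ} {P : Type*} [PartialOrder P] (c : P → Fin N) (L : P → ℕ)
    (Uc : P) (coin : ℕ → Bool) (Pi Delta : P → Option Bool) : Prop :=
  ∀ U : P, IsPrime c L U →
    (roundType L Uc U = none →
      Pi U = some (decide (Uc ≤ U)) ∧ Delta U = none) ∧
    (roundType L Uc U = some 1 →
      Pi U = SupMaj c (primeAnc c L U) Pi ∧ Delta U = ExistOp (primeAnc c L U) Delta) ∧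
    (roundType L Uc U = some 0 →
      Pi U = ExistTC coin (primeAnc c L U) Pi (L U) ∧ Delta U = SupMaj c (primeAnc c L U) Pi)

/-- `ExistTC` returns `v` if no unit of `S` carries the opposite value and the coin is `v`. -/
theorem existTC_eq_some_of_coin {P : Type*} {coin : ℕ → Bool} {S : Set P} {f : P → Option Bool}
    {ℓ : ℕ} {v : Bool} (hf : ∀ U ∈ S, f U = some v ∨ f U = none) (hcoin : coin (ℓ - 1) = v) :
    ExistTC coin S f ℓ = some v := by
  have hex : ExistOp S f = some v ∨ ExistOp S f = none := by
    unfold ExistOp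
    cases v <;> split_ifs <;> grind
  unfold ExistTC
  rcases hex with h | h <;> simp [h, hcoin]

/-- `SupMaj` returns `v` on a supermajority of units that all carry the value `v`. -/
theorem supMaj_eq_some_of_forall {N : ℕ} (hN : 0 < N) {P : Type*} {c : P → Fin N} {S : Set P}
    {f : P → Option Bool} {v : Bool} (hS : 2 * N ≤ 3 * suppCount c S)
    (hf : ∀ U ∈ S, f U = some v) : SupMaj c S f = some v := by
  have hv : {U ∈ S | f U = some v} = S := Set.sep_eq_self_iff_mem_true.2 hf
  cases v
  · have ht : {U ∈ S | f U = some true} = ∅ := by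
      ext U
      simp +contextual [hf]
    have h0 : ¬ 2 * N ≤ 3 * suppCount c (∅ : Set P) := by
      simp [suppCount, hN.ne']
    rw [SupMaj, ht, hv, if_neg h0, if_pos hS]
  · rw [SupMaj, hv, if_pos hS]

/-- The prime ancestors of a unit of positive level have supermajority support. -/
theorem IsLevelFn.two_mul_le_suppCount_primeAnc {N : ℕ} {P : Type*} [PartialOrder P]
    {c : P → Fin N} {L : P → ℕ} (hL : IsLevelFn c L) {U : P} (hU : 1 ≤ L U) :
    2 * N ≤ 3 * suppCount c (primeAnc c L U) := by
  have hset : primeAnc c L U = {X | HighAbove c U X ∧ L X = L U - 1 ∧ IsPrime c L X} := by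
    ext X
    simp only [primeAnc, Set.mem_ofPred_eq]
    tauto
  rw [hset]
  exact hL.2 U hU

/-- **Deterministic core of the expected-decision bound.** For `ℓ = L Uc + 2k` (`k ≥ 1`):
if every prime unit of level `ℓ - 1` has `Π` equal to `some v` or `none`, and the coin
`coin (ℓ - 1)` equals `v`, then every prime unit of level `ℓ + 2` has `Δ = some v`. -/
theorem aleph_decision_after_lucky_coin {P : Type*} [PartialOrder P] [Fintype P] {N : ℕ} (hN : 0 < N)
    (c : P → Fin N) (Correct : Finset (Fin N))
    (hfaulty : 3 * ((Finset.univ : Finset (Fin N)) \ Correct).card < N)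
    (hchain : ∀ U V : P, c U = c V → c U ∈ Correct → U ≤ V ∨ V ≤ U)
    (L : P → ℕ) (hL : IsLevelFn c L)
    (Uc : P) (hUc : IsPrime c L Uc) (coin : ℕ → Bool)
    (Pi Delta : P → Option Bool) (hrec : AlephRec c L Uc coin Pi Delta)
    (k : ℕ) (hk : 1 ≤ k) (v : Bool)
    (hPi : ∀ V : P, IsPrime c L V → L V = L Uc + 2 * k - 1 →
      Pi V = some v ∨ Pi V = none)
    (hcoin : coin (L Uc + 2 * k - 1) = v)
    (W : P) (hW : IsPrime c L W) (hWlev : L W = L Uc + 2 * k + 2) :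
    Delta W = some v := by
  have hround {U : P} {m : ℕ} (hU : L U = L Uc + m) (hm : 2 ≤ m) :
      roundType L Uc U = some (m % 2) := by
    rw [roundType, if_neg (by omega), hU, Nat.add_sub_cancel_left]
  have hcoinRound : ∀ U, IsPrime c L U → L U = L Uc + 2 * k → Pi U = some v := by
    intro U hU hlev
    rw [((hrec U hU).2.2 (by rw [hround hlev (by omega)]; congr 1; omega)).1]
    refine existTC_eq_some_of_coin (fun V hV => hPi V hV.1 ?_) (by rw [hlev, hcoin])
    rw [hV.2.2, hlev]
  have hoddRound : ∀ U, IsPrime c L U → L U = L Uc + (2 * k + 1) → Pi U = some v := by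
    intro U hU hlev
    rw [((hrec U hU).2.1 (by rw [hround hlev (by omega)]; congr 1; omega)).1]
    refine supMaj_eq_some_of_forall hN (hL.two_mul_le_suppCount_primeAnc (by omega))
      fun V hV => hcoinRound V hV.1 ?_
    have := hV.2.2
    omega
  have hWround : roundType L Uc W = some 0 := by
    rw [hround (m := 2 * k + 2) (by omega) (by omega)]
    congr 1
    omega
  rw [((hrec W hW).2.2 hWround).2]
  refine supMaj_eq_some_of_forall hN (hL.two_mul_le_suppCount_primeAnc (by omega))
    fun V hV => hoddRound V hV.1 ?_
  have := hV.2.2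
  omega
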